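/- Let k be a field of characteristic p > 0, let C = k[t₁,…,t_r]/(t₁ᵖ,…,t_rᵖ), and let N be a finite-dimensional C-module. Then pʳ · dim_k(Rad(C)·N) ≤ (pʳ − 1) · dim_k N, and equality holds if and only if N is a free C-module. -/

import Mathlib

open scoped TensorProduct

set_option synthInstance.maxHeartbeats 1000000
set_option maxHeartbeats 1000000

noncomputable section

def truncIdeal (k : Type*) [Field k] (n p : ℕ) : Ideal (MvPolynomial (Fin n) k) :=
  Ideal.span (Set.range fun i : Fin n => (MvPolynomial.X i : MvPolynomial (Fin n) k) ^ p)

abbrev TruncAlg (k : Type*) [Field k] (n p : ℕ) :=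
  MvPolynomial (Fin n) k ⧸ truncIdeal k n p

def xGen (k : Type*) [Field k] (n p : ℕ) (i : Fin n) : TruncAlg k n p :=
  Ideal.Quotient.mk (truncIdeal k n p) (MvPolynomial.X i)

def radIdeal (k : Type*) [Field k] (n p : ℕ) : Ideal (TruncAlg k n p) :=
  Ideal.span (Set.range (xGen k n p))

def xSpan (k : Type*) [Field k] (n p : ℕ) : Submodule k (TruncAlg k n p) :=
  Submodule.span k (Set.range (xGen k n p))

def IsFreeVia {C A : Type*} [CommRing C] [CommRing A] (α : C →+* A)
    (M : Type*) [AddCommGroup M] [Module A M] : Prop :=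
  letI : Module C M := Module.compHom M α
  Module.Free C M

def smulLinear (k : Type*) {A : Type*} (M : Type*) [CommSemiring k] [Semiring A]
    [AddCommMonoid M] [Module k M] [Module A M] [SMulCommClass k A M] (a : A) :
    M →ₗ[k] M where
  toFun m := a • m
  map_add' x y := smul_add a x y
  map_smul' c m := (smul_comm c a m).symm

def radPow (k A M : Type*) [CommSemiring k] [CommRing A] [AddCommMonoid M]
    [Module k M] [Module A M] [SMulCommClass k A M] (U : Set A) (j : ℕ) :
    Submodule k M :=
  ⨆ (u : Fin j → A) (_ : ∀ i, u i ∈ U), LinearMap.range (smulLinear k M (∏ i, u i))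

def socPow (k A M : Type*) [CommSemiring k] [CommRing A] [AddCommMonoid M]
    [Module k M] [Module A M] [SMulCommClass k A M] (U : Set A) (j : ℕ) :
    Submodule k M :=
  ⨅ (u : Fin j → A) (_ : ∀ i, u i ∈ U), LinearMap.ker (smulLinear k M (∏ i, u i))

section LocalAlgebra

variable {k A N : Type*} [Field k] [CommRing A] [Algebra k A] [AddCommGroup N] [Module k N]
  [Module A N] [IsScalarTower k A N]

/-- A `k`-basis of `N ⧸ J • N` lifts to a generating family of `N`. -/
theorem exists_surjective_of_le_jacobson [FiniteDimensional k N] (J : Ideal A)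
    (hJ : J ≤ Ideal.jacobson ⊥) :
    ∃ f : (Fin (Module.finrank k (N ⧸ (J • (⊤ : Submodule A N)).restrictScalars k)) → A) →ₗ[A] N,
      Function.Surjective f := by
  set P := (J • (⊤ : Submodule A N)).restrictScalars k
  let b := Module.finBasis k (N ⧸ P)
  choose v hv using fun i => P.mkQ_surjective (b i)
  refine ⟨Fintype.linearCombination A v, ?_⟩
  rw [← LinearMap.range_eq_top, Fintype.range_linearCombination]
  have : Module.Finite A N := Module.Finite.of_restrictScalars_finite k A N
  refine top_le_iff.mp (Submodule.le_of_le_smul_of_le_jacobson_bot Module.Finite.fg_top hJ ?_)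
  intro x _
  have hx : P.mkQ (x - ∑ i, b.repr (P.mkQ x) i • v i) = 0 := by
    rw [map_sub, map_sum]
    simp_rw [map_smul, hv]
    rw [b.sum_repr, sub_self]
  have hxP : x - ∑ i, b.repr (P.mkQ x) i • v i ∈ J • (⊤ : Submodule A N) := by
    rwa [Submodule.mkQ_apply, Submodule.Quotient.mk_eq_zero] at hx
  rw [← add_sub_cancel (∑ i, b.repr (P.mkQ x) i • v i) x]
  refine Submodule.add_mem_sup (Submodule.sum_mem _ fun i _ => ?_) hxP
  exact Submodule.smul_of_tower_mem _ _ (Submodule.subset_span ⟨i, rfl⟩)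

/-- If `A = k + J`, then `N ⧸ J • N` has dimension at most the rank of the free module `N`. -/
theorem finrank_quotient_smul_top_le [Nontrivial A] [Module.Finite A N] [Module.Free A N]
    (J : Ideal A) (hkJ : ∀ a : A, ∃ c : k, a - algebraMap k A c ∈ J) :
    Module.finrank k (N ⧸ (J • (⊤ : Submodule A N)).restrictScalars k) ≤ Module.finrank A N := by
  set P := (J • (⊤ : Submodule A N)).restrictScalars k
  let b := Module.finBasis A N
  have hspan : Submodule.span k (Set.range fun i => P.mkQ (b i)) = ⊤ := by
    refine top_le_iff.mp fun y _ => ?_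
    obtain ⟨x, rfl⟩ := P.mkQ_surjective y
    rw [← b.sum_repr x, map_sum]
    refine Submodule.sum_mem _ fun i _ => ?_
    obtain ⟨c, hc⟩ := hkJ (b.repr x i)
    have hmem : (b.repr x i - algebraMap k A c) • b i ∈ P :=
      (Submodule.smul_mem_smul hc Submodule.mem_top : _ ∈ J • (⊤ : Submodule A N))
    have h : P.mkQ (b.repr x i • b i) = c • P.mkQ (b i) := by
      rw [sub_smul, algebraMap_smul] at hmem
      rw [← P.mkQ.map_smul]
      exact (Submodule.Quotient.eq P).mpr hmem
    rw [h]
    exact Submodule.smul_mem _ _ (Submodule.subset_span ⟨i, rfl⟩)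
  have h := finrank_range_le_card (R := k) fun i => P.mkQ (b i)
  rwa [Set.finrank, hspan, finrank_top, Fintype.card_fin] at h

theorem finrank_le_mul_finrank_quotient_smul_top [FiniteDimensional k A] [FiniteDimensional k N]
    (J : Ideal A) (hJ : J ≤ Ideal.jacobson ⊥) :
    Module.finrank k N ≤ Module.finrank k A *
      Module.finrank k (N ⧸ (J • (⊤ : Submodule A N)).restrictScalars k) := by
  obtain ⟨f, hf⟩ := exists_surjective_of_le_jacobson (k := k) (N := N) J hJ
  have h := LinearMap.finrank_le_finrank_of_surjective (f := f.restrictScalars k) hf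
  rwa [Module.finrank_pi_fintype, Finset.sum_const, Finset.card_univ, Fintype.card_fin,
    smul_eq_mul, mul_comm] at h

theorem finrank_eq_mul_finrank_quotient_smul_top_iff_free [Nontrivial A] [FiniteDimensional k A]
    [FiniteDimensional k N] (J : Ideal A) (hJ : J ≤ Ideal.jacobson ⊥)
    (hkJ : ∀ a : A, ∃ c : k, a - algebraMap k A c ∈ J) :
    Module.finrank k N = Module.finrank k A *
      Module.finrank k (N ⧸ (J • (⊤ : Submodule A N)).restrictScalars k) ↔ Module.Free A N := by
  have : Module.Finite A N := Module.Finite.of_restrictScalars_finite k A N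
  constructor
  · intro h
    obtain ⟨f, hf⟩ := exists_surjective_of_le_jacobson (k := k) (N := N) J hJ
    have hinj : Function.Injective (f.restrictScalars k) := by
      refine (LinearMap.injective_iff_surjective_of_finrank_eq_finrank ?_).mpr hf
      rw [Module.finrank_pi_fintype, Finset.sum_const, Finset.card_univ, Fintype.card_fin,
        smul_eq_mul, mul_comm, h]
    exact Module.Free.of_equiv (LinearEquiv.ofBijective f ⟨hinj, hf⟩)
  · intro _
    refine le_antisymm (finrank_le_mul_finrank_quotient_smul_top J hJ) ?_
    rw [← Module.finrank_mul_finrank k A N]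
    exact Nat.mul_le_mul_left _ (finrank_quotient_smul_top_le J hkJ)

end LocalAlgebra

section TruncAlg

variable (k : Type*) [Field k] (r p : ℕ)

theorem mem_truncIdeal_iff (f : MvPolynomial (Fin r) k) :
    f ∈ truncIdeal k r p ↔ ∀ e ∈ f.support, ∃ i, p ≤ e i := by
  have h : truncIdeal k r p = Ideal.span ((fun e => MvPolynomial.monomial e (1 : k)) ''
      Set.range fun i : Fin r => Finsupp.single i p) := by
    rw [truncIdeal, ← Set.range_comp]
    congr 2
    ext1 i
    exact MvPolynomial.X_pow_eq_monomial
  rw [h, MvPolynomial.mem_ideal_span_monomial_image]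
  simp

/-- The coefficients of the monomials all of whose exponents are less than `p`. -/
def truncCoeff : MvPolynomial (Fin r) k →ₗ[k] ((Fin r → Fin p) → k) :=
  LinearMap.pi fun e => MvPolynomial.lcoeff k (Finsupp.equivFunOnFinite.symm fun i => (e i : ℕ))

theorem truncCoeff_apply (f : MvPolynomial (Fin r) k) (e : Fin r → Fin p) :
    truncCoeff k r p f e = f.coeff (Finsupp.equivFunOnFinite.symm fun i => (e i : ℕ)) := rfl

theorem ker_truncCoeff :
    LinearMap.ker (truncCoeff k r p) = (truncIdeal k r p).restrictScalars k := by
  ext f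
  rw [LinearMap.mem_ker, Submodule.restrictScalars_mem, mem_truncIdeal_iff]
  constructor
  · intro h e he
    by_contra! hlt
    refine MvPolynomial.mem_support_iff.mp he ?_
    have := congrFun h fun i => ⟨e i, hlt i⟩
    rw [truncCoeff_apply, Pi.zero_apply] at this
    convert this
    ext i
    simp
  · intro h
    ext e
    rw [truncCoeff_apply]
    by_contra hne
    obtain ⟨i, hi⟩ := h _ (MvPolynomial.mem_support_iff.mpr hne)
    simp only [Finsupp.equivFunOnFinite_symm_apply_apply] at hi
    exact absurd (e i).isLt (not_lt.mpr hi)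

theorem truncCoeff_surjective : Function.Surjective (truncCoeff k r p) := by
  intro g
  refine ⟨∑ e, MvPolynomial.monomial (Finsupp.equivFunOnFinite.symm fun i => (e i : ℕ)) (g e), ?_⟩
  ext e
  rw [truncCoeff_apply, MvPolynomial.coeff_sum, Finset.sum_eq_single e]
  · simp
  · intro e' _ hne
    rw [MvPolynomial.coeff_monomial, if_neg]
    intro h
    refine hne (funext fun i => Fin.ext ?_)
    exact congrFun (Finsupp.equivFunOnFinite.symm.injective h) i
  · simp

/-- The truncated polynomial algebra has the monomials with exponents less than `p` as a basis. -/
def truncAlgEquiv : TruncAlg k r p ≃ₗ[k] ((Fin r → Fin p) → k) :=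
  (Submodule.Quotient.restrictScalarsEquiv k (truncIdeal k r p)).symm ≪≫ₗ
    Submodule.quotEquivOfEq _ _ (ker_truncCoeff k r p).symm ≪≫ₗ
    (truncCoeff k r p).quotKerEquivOfSurjective (truncCoeff_surjective k r p)

instance finiteDimensional_truncAlg : FiniteDimensional k (TruncAlg k r p) :=
  Module.Finite.equiv (truncAlgEquiv k r p).symm

theorem finrank_truncAlg : Module.finrank k (TruncAlg k r p) = p ^ r := by
  rw [(truncAlgEquiv k r p).finrank_eq]
  simp

theorem radIdeal_le_jacobson : radIdeal k r p ≤ Ideal.jacobson ⊥ := by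
  refine le_trans (Ideal.span_le.mpr ?_) (Ideal.radical_le_jacobson (I := ⊥))
  rintro _ ⟨i, rfl⟩
  refine ⟨p, ?_⟩
  rw [xGen, ← map_pow, Ideal.mem_bot, Ideal.Quotient.eq_zero_iff_mem]
  exact Ideal.subset_span ⟨i, rfl⟩

theorem exists_sub_algebraMap_mem_radIdeal (a : TruncAlg k r p) :
    ∃ c : k, a - algebraMap k (TruncAlg k r p) c ∈ radIdeal k r p := by
  obtain ⟨f, rfl⟩ := Ideal.Quotient.mk_surjective a
  induction f using MvPolynomial.induction_on with
  | C c =>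
    refine ⟨c, ?_⟩
    have h : Ideal.Quotient.mk (truncIdeal k r p) (MvPolynomial.C c) =
      algebraMap k (TruncAlg k r p) c := rfl
    rw [h, sub_self]
    exact zero_mem _
  | add f g hf hg =>
    obtain ⟨c, hc⟩ := hf
    obtain ⟨d, hd⟩ := hg
    refine ⟨c + d, ?_⟩
    rw [map_add, map_add, add_sub_add_comm]
    exact add_mem hc hd
  | mul_X f i _ =>
    refine ⟨0, ?_⟩
    rw [map_zero, sub_zero, map_mul]
    exact Ideal.mul_mem_left _ _ (Ideal.subset_span ⟨i, rfl⟩)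

end TruncAlg

/-- For `C = k[t₁,…,t_r]/(tᵢᵖ)` and a finite-dimensional `C`-module `N`:
`pʳ · dim_k(Rad(C)·N) ≤ (pʳ − 1) · dim_k N`, with equality iff `N` is a free `C`-module. -/
theorem statement2 {k : Type*} [Field k] (p r : ℕ) [Fact p.Prime] [CharP k p]
    (N : Type*) [AddCommGroup N] [Module k N] [Module (TruncAlg k r p) N]
    [IsScalarTower k (TruncAlg k r p) N] [FiniteDimensional k N] :
    p ^ r * Module.finrank k
        ↥(Submodule.restrictScalars k
          ((radIdeal k r p) • (⊤ : Submodule (TruncAlg k r p) N)))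
      ≤ (p ^ r - 1) * Module.finrank k N ∧
    (p ^ r * Module.finrank k
        ↥(Submodule.restrictScalars k
          ((radIdeal k r p) • (⊤ : Submodule (TruncAlg k r p) N)))
      = (p ^ r - 1) * Module.finrank k N ↔ Module.Free (TruncAlg k r p) N) := by
  have hp : 0 < p ^ r := pow_pos (Fact.out : p.Prime).pos r
  have hA := finrank_truncAlg k r p
  have : Nontrivial (TruncAlg k r p) := Module.nontrivial_of_finrank_pos (R := k) (hA ▸ hp)
  have hle := finrank_le_mul_finrank_quotient_smul_top (k := k) (N := N) _
    (radIdeal_le_jacobson k r p)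
  rw [← finrank_eq_mul_finrank_quotient_smul_top_iff_free (k := k) (N := N) _
    (radIdeal_le_jacobson k r p) (exists_sub_algebraMap_mem_radIdeal k r p)]
  have hadd := Submodule.finrank_quotient_add_finrank
    ((radIdeal k r p • (⊤ : Submodule (TruncAlg k r p) N)).restrictScalars k)
  rw [hA] at hle ⊢
  have hmul := congrArg (p ^ r * ·) hadd
  simp only [mul_add] at hmul
  rw [Nat.sub_mul, one_mul]
  have hN := Nat.le_mul_of_pos_left (Module.finrank k N) hp
  omega

end
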